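/- For every integer k with 1 ≤ k ≤ d−1, the degree from above of the vertex p(U_d^k) of the White Whale H_∞^+(d,1) equals C(d−1, k); that is, the number of vectors g ∈ G_d \ U_d^k such that p(U_d^k ∪ {g}) is a vertex of H_∞^+(d,1) equals the binomial coefficient C(d−1, k). -/

import Mathlib

/-- The set `G_d` of generators of the White Whale:
all nonzero 0/1-valued vectors of `ℝ^d`. -/
def whaleGens (d : ℕ) : Set (Fin d → ℝ) :=
  {g | g ≠ 0 ∧ ∀ i, g i = 0 ∨ g i = 1}

/-- The point `p(S)`: the sum of the vectors in `S` (with `p(∅) = 0`). -/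
noncomputable def whaleSum {d : ℕ} (S : Set (Fin d → ℝ)) : Fin d → ℝ :=
  ∑ᶠ g ∈ S, g

/-- The White Whale `H_∞^+(d,1)`: the convex hull of the points `p(S)`
over all subsets `S ⊆ G_d`. -/
noncomputable def whiteWhale (d : ℕ) : Set (Fin d → ℝ) :=
  convexHull ℝ {x | ∃ S : Set (Fin d → ℝ), S ⊆ whaleGens d ∧ x = whaleSum S}

/-- A vertex of the White Whale is an extreme point of it. -/
def IsWhaleVertex (d : ℕ) (x : Fin d → ℝ) : Prop :=
  x ∈ Set.extremePoints ℝ (whiteWhale d)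

/-- The set U_d^k: vectors of G_d whose last coordinate is 1 and which have
at most k nonzero coordinates. -/
def whaleU (d k : ℕ) (hd : 0 < d) : Set (Fin d → ℝ) :=
  {g | g ∈ whaleGens d ∧ g ⟨d - 1, Nat.sub_lt hd one_pos⟩ = 1 ∧
       {i : Fin d | g i ≠ 0}.ncard ≤ k}

/-- The 0/1-valued vector with support `s`. -/
def indVec {d : ℕ} (s : Finset (Fin d)) : Fin d → ℝ := fun i => if i ∈ s then 1 else 0

lemma indVec_apply {d : ℕ} (s : Finset (Fin d)) (i : Fin d) :
    indVec s i = if i ∈ s then 1 else 0 := rfl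

lemma indVec_injective {d : ℕ} : Function.Injective (indVec (d := d)) := by
  intro s t h
  ext i
  have hi := congrFun h i
  by_cases hs : i ∈ s <;> by_cases ht : i ∈ t <;> simp_all [indVec_apply]

lemma indVec_eq_zero {d : ℕ} {s : Finset (Fin d)} : indVec s = 0 ↔ s = ∅ := by
  rw [← indVec_injective.eq_iff]
  have h : indVec (∅ : Finset (Fin d)) = 0 := by ext i; simp [indVec_apply]
  rw [h]

lemma indVec_union {d : ℕ} {s t : Finset (Fin d)} (h : Disjoint s t) :
    indVec (s ∪ t) = indVec s + indVec t := by
  ext i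
  have : i ∈ s → i ∉ t := fun hi => Finset.disjoint_left.mp h hi
  by_cases hs : i ∈ s <;> by_cases ht : i ∈ t <;> simp_all [indVec_apply]

lemma indVec_mem_whaleGens {d : ℕ} {s : Finset (Fin d)} :
    indVec s ∈ whaleGens d ↔ s.Nonempty := by
  rw [Finset.nonempty_iff_ne_empty, Ne, ← indVec_eq_zero]
  refine ⟨fun h => h.1, fun h => ⟨h, fun i => ?_⟩⟩
  by_cases hs : i ∈ s <;> simp [indVec_apply, hs]

lemma exists_indVec_of_mem_whaleGens {d : ℕ} {g : Fin d → ℝ} (hg : g ∈ whaleGens d) :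
    ∃ s, s.Nonempty ∧ indVec s = g := by
  classical
  have h : indVec (Finset.univ.filter fun i => g i ≠ 0) = g := by
    ext i
    rcases hg.2 i with h | h <;> simp [indVec_apply, h]
  exact ⟨_, indVec_mem_whaleGens.mp (by rwa [h]), h⟩

lemma whaleGens_finite (d : ℕ) : (whaleGens d).Finite := by
  refine (Set.finite_range (indVec (d := d))).subset fun g hg => ?_
  obtain ⟨s, -, hs⟩ := exists_indVec_of_mem_whaleGens hg
  exact ⟨s, hs⟩

lemma indVec_mem_whaleU {d k : ℕ} {hd : 0 < d} {s : Finset (Fin d)} :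
    indVec s ∈ whaleU d k hd ↔ (⟨d - 1, Nat.sub_lt hd one_pos⟩ : Fin d) ∈ s ∧ s.card ≤ k := by
  have hsupp : {i : Fin d | indVec s i ≠ 0} = s := by ext i; simp [indVec_apply]
  simp only [whaleU, Set.mem_ofPred_eq, indVec_mem_whaleGens, hsupp, Set.ncard_coe_finset]
  constructor
  · rintro ⟨-, h, h'⟩
    exact ⟨by by_contra hn; simp [indVec_apply, hn] at h, h'⟩
  · rintro ⟨h, h'⟩
    exact ⟨⟨_, h⟩, by simp [indVec_apply, h], h'⟩

lemma whaleSum_mem_whiteWhale {d : ℕ} {S : Set (Fin d → ℝ)} (hS : S ⊆ whaleGens d) :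
    whaleSum S ∈ whiteWhale d :=
  subset_convexHull ℝ _ ⟨S, hS, rfl⟩

lemma whaleSum_union {d : ℕ} {S T : Set (Fin d → ℝ)} (hS : S ⊆ whaleGens d)
    (hT : T ⊆ whaleGens d) (h : Disjoint S T) :
    whaleSum (S ∪ T) = whaleSum S + whaleSum T :=
  finsum_mem_union h ((whaleGens_finite d).subset hS) ((whaleGens_finite d).subset hT)

lemma whaleSum_singleton {d : ℕ} (g : Fin d → ℝ) : whaleSum {g} = g :=
  finsum_mem_singleton

lemma whaleSum_pair {d : ℕ} {g h : Fin d → ℝ} (hgh : g ≠ h) : whaleSum {g, h} = g + h :=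
  finsum_mem_pair hgh

/-- If generators inside `S` and generators outside `S` have the same nonzero sum,
then `p(S)` is not a vertex. -/
lemma not_isWhaleVertex_of_whaleSum_eq {d : ℕ} {S P Q : Set (Fin d → ℝ)}
    (hS : S ⊆ whaleGens d) (hP : P ⊆ S) (hQ : Q ⊆ whaleGens d) (hQS : Disjoint S Q)
    (h : whaleSum P = whaleSum Q) (h0 : whaleSum Q ≠ 0) :
    ¬ IsWhaleVertex d (whaleSum S) := by
  intro hv
  have hminus : whaleSum S = whaleSum (S \ P) + whaleSum P := by
    rw [← whaleSum_union (Set.sdiff_subset.trans hS) (hP.trans hS) Set.disjoint_sdiff_left,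
      Set.sdiff_union_of_subset hP]
  have hplus := whaleSum_union hS hQ hQS
  have hmid : whaleSum S ∈ openSegment ℝ (whaleSum (S ∪ Q)) (whaleSum (S \ P)) := by
    refine ⟨1 / 2, 1 / 2, by norm_num, by norm_num, by norm_num, ?_⟩
    rw [hplus, eq_sub_of_add_eq hminus.symm, h]
    module
  have := hv.2 (whaleSum_mem_whiteWhale (Set.union_subset hS hQ))
    (whaleSum_mem_whiteWhale (Set.sdiff_subset.trans hS)) hmid
  rw [hplus] at this
  exact h0 (by simpa using this)

lemma map_whaleSum {d : ℕ} (φ : (Fin d → ℝ) →ₗ[ℝ] ℝ) {S : Set (Fin d → ℝ)}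
    (hS : S ⊆ whaleGens d) [DecidablePred (· ∈ S)] :
    φ (whaleSum S) = ∑ g ∈ (whaleGens_finite d).toFinset, if g ∈ S then φ g else 0 := by
  have h : whaleSum S = ∑ g ∈ (whaleGens_finite d).toFinset with g ∈ S, g := by
    refine finsum_mem_eq_sum_of_inter_support_eq _ ?_
    congr 1
    ext g
    simpa using fun hg => hS hg
  rw [h, map_sum, Finset.sum_filter]

/-- If a linear functional is positive on `S` and negative on the other generators,
then `p(S)` is a vertex. -/
lemma isWhaleVertex_of_separated {d : ℕ} {S : Set (Fin d → ℝ)} (hS : S ⊆ whaleGens d)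
    (φ : (Fin d → ℝ) →ₗ[ℝ] ℝ) (hpos : ∀ g ∈ S, 0 < φ g)
    (hneg : ∀ g ∈ whaleGens d, g ∉ S → φ g < 0) :
    IsWhaleVertex d (whaleSum S) := by
  classical
  have hlt : ∀ T ⊆ whaleGens d, T ≠ S → φ (whaleSum T) < φ (whaleSum S) := by
    intro T hT hne
    rw [map_whaleSum φ hT, map_whaleSum φ hS]
    obtain ⟨g, hg⟩ : ∃ g, ¬ (g ∈ T ↔ g ∈ S) := by
      by_contra! h
      exact hne (Set.ext h)
    refine Finset.sum_lt_sum (fun i hi => ?_) ⟨g, ?_, ?_⟩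
    · have hi' : i ∈ whaleGens d := by simpa using hi
      by_cases h1 : i ∈ T <;> by_cases h2 : i ∈ S <;> simp only [h1, h2, if_true, if_false, le_refl]
      · exact (hneg i hi' h2).le
      · exact (hpos i h2).le
    · have : g ∈ whaleGens d := by
        by_contra h
        exact hg ⟨fun h' => absurd (hT h') h, fun h' => absurd (hS h') h⟩
      simpa using this
    · by_cases h1 : g ∈ T <;> by_cases h2 : g ∈ S <;> simp only [h1, h2, if_true, if_false]
      · exact absurd (iff_of_true h1 h2) hg
      · exact hneg g (hT h1) h2
      · exact hpos g h2
      · exact absurd (iff_of_false h1 h2) hg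
  set p := whaleSum S
  have hconv : Convex ℝ {x | x = p ∨ φ x < φ p} := by
    intro x hx y hy a b ha hb hab
    have hle : ∀ z, z = p ∨ φ z < φ p → φ z ≤ φ p := by
      rintro z (rfl | h)
      exacts [le_rfl, h.le]
    rcases ha.eq_or_lt with rfl | ha'
    · obtain rfl : b = 1 := by linarith
      simpa using hy
    rcases hb.eq_or_lt with rfl | hb'
    · obtain rfl : a = 1 := by linarith
      simpa using hx
    have hval : φ p = a * φ p + b * φ p := by rw [← add_mul, hab, one_mul]
    have hx' := hle x hx
    have hy' := hle y hy
    rcases hx with rfl | hx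
    · rcases hy with rfl | hy
      · left
        rw [← add_smul, hab, one_smul]
      · right
        simp only [map_add, map_smul, smul_eq_mul]
        nlinarith
    · right
      simp only [map_add, map_smul, smul_eq_mul]
      nlinarith
  have hsub : ∀ x ∈ whiteWhale d, x = p ∨ φ x < φ p := by
    refine fun x hx => convexHull_min ?_ hconv hx
    rintro _ ⟨T, hT, rfl⟩
    by_cases hTS : T = S
    · left; rw [hTS]
    · exact Or.inr (hlt T hT hTS)
  refine ⟨whaleSum_mem_whiteWhale hS, fun x hx y hy hxy => ?_⟩
  obtain ⟨a, b, ha, hb, hab, hsum⟩ := hxy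
  rcases hsub x hx with h | h
  · exact h
  · exfalso
    have hy' : φ y ≤ φ p := by
      rcases hsub y hy with h | h
      exacts [h ▸ le_rfl, h.le]
    have hval : φ p = a * φ p + b * φ p := by rw [← add_mul, hab, one_mul]
    have := congrArg φ hsum
    simp only [map_add, map_smul, smul_eq_mul] at this
    nlinarith

/-- The linear functional with coefficients `c`. -/
noncomputable def coordFunctional {d : ℕ} (c : Fin d → ℝ) : (Fin d → ℝ) →ₗ[ℝ] ℝ :=
  ∑ i, c i • LinearMap.proj i

lemma coordFunctional_indVec {d : ℕ} (c : Fin d → ℝ) (s : Finset (Fin d)) :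
    coordFunctional c (indVec s) = ∑ i ∈ s, c i := by
  simp [coordFunctional, LinearMap.sum_apply, indVec_apply]

/-- The coefficients of a functional separating `U_d^k` together with the vector
supported on `A ∪ {L}`, where `A` has `k` elements, from the other generators. -/
noncomputable def separatingCoeff {d : ℕ} (k : ℕ) (L : Fin d) (A : Finset (Fin d)) :
    Fin d → ℝ :=
  fun i => if i = L then 2 * (k : ℝ) ^ 2 + 1 else if i ∈ A then -(2 * k) else -(2 * k) - 2

lemma sum_separatingCoeff {d : ℕ} (k : ℕ) {L : Fin d} (A : Finset (Fin d))
    {B : Finset (Fin d)} (hB : L ∉ B) :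
    ∑ i ∈ B, separatingCoeff k L A i = -(2 * k * B.card) - 2 * (B \ A).card := by
  have h : ∀ i ∈ B, separatingCoeff k L A i = -(2 * (k : ℝ)) - if i ∉ A then 2 else 0 := by
    intro i hi
    have hiL : i ≠ L := fun h => hB (h ▸ hi)
    by_cases hA : i ∈ A <;> simp [separatingCoeff, hiL, hA]
  rw [Finset.sum_congr rfl h, Finset.sum_sub_distrib, ← Finset.sum_filter,
    ← Finset.sdiff_eq_filter]
  simp only [Finset.sum_const, nsmul_eq_mul]
  ring

lemma isWhaleVertex_whaleU_union {d k : ℕ} (hd : 0 < d) (hk : 1 ≤ k) {A : Finset (Fin d)}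
    (hL : (⟨d - 1, Nat.sub_lt hd one_pos⟩ : Fin d) ∉ A) (hA : A.card = k) :
    IsWhaleVertex d (whaleSum (whaleU d k hd ∪
      {indVec (insert (⟨d - 1, Nat.sub_lt hd one_pos⟩ : Fin d) A)})) := by
  set L : Fin d := ⟨d - 1, Nat.sub_lt hd one_pos⟩
  have hk' : (1 : ℝ) ≤ k := by exact_mod_cast hk
  have hS : whaleU d k hd ∪ {indVec (insert L A)} ⊆ whaleGens d :=
    Set.union_subset (fun g hg => hg.1) (by simp [indVec_mem_whaleGens])
  have hval : ∀ s : Finset (Fin d), L ∈ s → ∑ i ∈ s, separatingCoeff k L A i =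
      2 * (k : ℝ) ^ 2 + 1 - 2 * k * (s.erase L).card - 2 * (s.erase L \ A).card := by
    intro s hs
    rw [← Finset.add_sum_erase _ _ hs, sum_separatingCoeff k A (Finset.notMem_erase L s)]
    simp only [separatingCoeff, if_true]
    ring
  refine isWhaleVertex_of_separated hS (coordFunctional (separatingCoeff k L A)) ?_ ?_
  · intro g hg
    obtain ⟨s, -, rfl⟩ := exists_indVec_of_mem_whaleGens (hS hg)
    rw [coordFunctional_indVec]
    rcases hg with hg | hg
    · obtain ⟨hLs, hcard⟩ := indVec_mem_whaleU.mp hg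
      rw [hval s hLs]
      have h1 : ((s.erase L).card : ℝ) + 1 ≤ k := by
        exact_mod_cast (Finset.card_erase_add_one hLs).trans_le hcard
      have h2 : ((s.erase L \ A).card : ℝ) ≤ (s.erase L).card := by
        exact_mod_cast Finset.card_le_card Finset.sdiff_subset
      nlinarith
    · obtain rfl := indVec_injective hg
      rw [hval _ (Finset.mem_insert_self L A), Finset.erase_insert hL, hA]
      simp only [Finset.sdiff_self, Finset.card_empty, Nat.cast_zero]
      nlinarith
  · intro g hg hgS
    obtain ⟨s, hs, rfl⟩ := exists_indVec_of_mem_whaleGens hg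
    rw [coordFunctional_indVec]
    simp only [Set.mem_union, Set.mem_singleton_iff, indVec_mem_whaleU, not_or, not_and,
      indVec_injective.eq_iff] at hgS
    by_cases hLs : L ∈ s
    · rw [hval s hLs]
      have h1 : k ≤ (s.erase L).card := by
        have := Finset.card_erase_add_one hLs
        have := hgS.1 hLs
        omega
      rcases h1.eq_or_lt with h1 | h1
      · have hpos : 0 < (s.erase L \ A).card := by
          rw [Finset.card_pos, Finset.sdiff_nonempty]
          intro hsub
          apply hgS.2
          rw [← Finset.eq_of_subset_of_card_le hsub (by omega), Finset.insert_erase hLs]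
        have hpos' : (1 : ℝ) ≤ (s.erase L \ A).card := by exact_mod_cast hpos
        rw [← h1]
        nlinarith
      · have h1' : (k : ℝ) + 1 ≤ (s.erase L).card := by exact_mod_cast h1
        have : (0 : ℝ) ≤ (s.erase L \ A).card := by positivity
        nlinarith
    · rw [sum_separatingCoeff k A hLs]
      have h1 : (1 : ℝ) ≤ s.card := by exact_mod_cast hs.card_pos
      have : (0 : ℝ) ≤ (s \ A).card := by positivity
      nlinarith

lemma mem_and_card_of_isWhaleVertex {d k : ℕ} (hd : 0 < d) (hk1 : 1 ≤ k) (hk2 : k ≤ d - 1)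
    {s : Finset (Fin d)} (hs : s.Nonempty) (hsU : indVec s ∉ whaleU d k hd)
    (hv : IsWhaleVertex d (whaleSum (whaleU d k hd ∪ {indVec s}))) :
    (⟨d - 1, Nat.sub_lt hd one_pos⟩ : Fin d) ∈ s ∧ s.card = k + 1 := by
  set L : Fin d := ⟨d - 1, Nat.sub_lt hd one_pos⟩
  have hS : whaleU d k hd ∪ {indVec s} ⊆ whaleGens d :=
    Set.union_subset (fun g hg => hg.1) (by simpa [indVec_mem_whaleGens] using hs)
  have hmem : ∀ t, indVec t ∈ whaleU d k hd ∪ {indVec s} ↔ (L ∈ t ∧ t.card ≤ k) ∨ t = s := by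
    intro t
    rw [Set.mem_union, indVec_mem_whaleU, Set.mem_singleton_iff, indVec_injective.eq_iff]
  have hLs : L ∈ s := by
    by_contra hLs
    have hscard : s.card ≤ d - 1 := by
      have := Finset.card_lt_univ_of_notMem hLs
      simp at this
      omega
    obtain ⟨t, hLt, hts, htcard⟩ : ∃ t : Finset (Fin d), {L} ⊆ t ∧ t ⊆ sᶜ ∧
        t.card = min k (d - s.card) :=
      Finset.exists_subsuperset_card_eq (by simpa using hLs) (by simp; omega)
        (by simp [Finset.card_compl])
    have hLt : L ∈ t := by simpa using hLt
    have hdisj : Disjoint s t := (Finset.disjoint_left.mpr fun i hi hi' => by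
      simpa [hi] using hts hi')
    have hne : s ≠ t := fun h => hLs (h ▸ hLt)
    refine not_isWhaleVertex_of_whaleSum_eq hS (P := {indVec s, indVec t})
      (Q := {indVec (s ∪ t)}) ?_ ?_ ?_ ?_ ?_ hv
    · rintro _ (rfl | rfl)
      · exact (hmem s).mpr (Or.inr rfl)
      · exact (hmem t).mpr (Or.inl ⟨hLt, by omega⟩)
    · simpa [indVec_mem_whaleGens] using Or.inl hs
    · rw [Set.disjoint_singleton_right, hmem, Finset.card_union_of_disjoint hdisj]
      have := hs.card_pos
      rintro (⟨-, h⟩ | h)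
      · omega
      · exact hLs (h ▸ Finset.mem_union_right s hLt)
    · rw [whaleSum_pair (indVec_injective.ne hne), whaleSum_singleton, indVec_union hdisj]
    · rw [whaleSum_singleton, Ne, indVec_eq_zero]
      exact (hs.mono Finset.subset_union_left).ne_empty
  refine ⟨hLs, ?_⟩
  have hcard : k + 1 ≤ s.card := by
    by_contra h
    exact hsU (indVec_mem_whaleU.mpr ⟨hLs, by omega⟩)
  by_contra hne
  obtain ⟨t, hLt, hts, htcard⟩ : ∃ t : Finset (Fin d), {L} ⊆ t ∧ t ⊆ s ∧ t.card = k + 1 :=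
    Finset.exists_subsuperset_card_eq (by simpa using hLs) (by simp) hcard
  have hLt : L ∈ t := by simpa using hLt
  have hts' : t ≠ s := fun h => hne (h ▸ htcard)
  have hdiff : (s \ t).Nonempty :=
    Finset.sdiff_nonempty.mpr fun h => hts' (hts.antisymm h)
  have hLdiff : L ∉ s \ t := by simp [hLt]
  refine not_isWhaleVertex_of_whaleSum_eq hS (P := {indVec s})
    (Q := {indVec t, indVec (s \ t)}) ?_ ?_ ?_ ?_ ?_ hv
  · exact Set.subset_union_right
  · rintro _ (rfl | rfl)
    · exact indVec_mem_whaleGens.mpr ⟨L, hLt⟩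
    · exact indVec_mem_whaleGens.mpr hdiff
  · rw [Set.disjoint_right]
    rintro _ (rfl | rfl) h
    · rcases (hmem _).mp h with h | h
      · omega
      · exact hts' h
    · rcases (hmem _).mp h with h | h
      · exact hLdiff h.1
      · exact hLdiff (h.symm.subset hLs)
  all_goals rw [whaleSum_pair (indVec_injective.ne fun h => hLdiff (Finset.Subset.antisymm_iff.mp h |>.1 hLt)),
    ← indVec_union Finset.disjoint_sdiff, Finset.union_sdiff_of_subset hts]
  · exact whaleSum_singleton _
  · exact fun h => hs.ne_empty (indVec_eq_zero.mp h)

/-- The degree from above of the vertex p(U_d^k) equals C(d−1, k). -/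
theorem whaleU_degree_above (d k : ℕ) (hd : 2 ≤ d) (hk1 : 1 ≤ k) (hk2 : k ≤ d - 1) :
    {g | g ∈ whaleGens d ∧ g ∉ whaleU d k (by omega) ∧
      IsWhaleVertex d (whaleSum (whaleU d k (by omega) ∪ {g}))}.ncard =
      (d - 1).choose k := by
  have hd0 : 0 < d := by omega
  set L : Fin d := ⟨d - 1, Nat.sub_lt hd0 one_pos⟩
  have himage : {g | g ∈ whaleGens d ∧ g ∉ whaleU d k (by omega) ∧
      IsWhaleVertex d (whaleSum (whaleU d k (by omega) ∪ {g}))} =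
      (fun A => indVec (insert L A)) '' (Finset.powersetCard k (Finset.univ.erase L) : Set _) := by
    ext g
    simp only [Set.mem_ofPred_eq, Set.mem_image, Finset.mem_coe, Finset.mem_powersetCard]
    constructor
    · rintro ⟨hg, hgU, hv⟩
      obtain ⟨s, hs, rfl⟩ := exists_indVec_of_mem_whaleGens hg
      obtain ⟨hLs, hcard⟩ := mem_and_card_of_isWhaleVertex hd0 hk1 hk2 hs hgU hv
      refine ⟨s.erase L, ⟨Finset.erase_subset_erase L (Finset.subset_univ s), ?_⟩, ?_⟩
      · rw [Finset.card_erase_of_mem hLs, hcard, Nat.add_sub_cancel]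
      · rw [Finset.insert_erase hLs]
    · rintro ⟨A, ⟨hA, hcard⟩, rfl⟩
      have hLA : L ∉ A := fun h => Finset.notMem_erase L _ (hA h)
      refine ⟨indVec_mem_whaleGens.mpr (Finset.insert_nonempty L A), fun h => ?_,
        isWhaleVertex_whaleU_union hd0 hk1 hLA hcard⟩
      have := (indVec_mem_whaleU.mp h).2
      rw [Finset.card_insert_of_notMem hLA] at this
      omega
  rw [himage, Set.InjOn.ncard_image, Set.ncard_coe_finset, Finset.card_powersetCard,
    Finset.card_erase_of_mem (Finset.mem_univ L), Finset.card_univ, Fintype.card_fin]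
  intro A hA B hB hAB
  simp only [Finset.mem_coe, Finset.mem_powersetCard] at hA hB
  rw [← Finset.erase_insert fun h => Finset.notMem_erase L _ (hA.1 h), indVec_injective hAB,
    Finset.erase_insert fun h => Finset.notMem_erase L _ (hB.1 h)]
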